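/- Every nonzero ideal I ⊆ P has a finite Janet basis: there exists a finite set H ⊂ I of nonzero polynomials such that for every nonzero f ∈ I there is h ∈ H with lm(f) = lm(h)·m for a monomial m involving only the Janet multiplicative variables of lm(h) with respect to the set lm(H), and no two distinct h, h' ∈ H satisfy lm(h) = lm(h')·m' with m' a monomial in the Janet multiplicative variables of lm(h') with respect to lm(H). -/

import Mathlib

open MvPolynomial Finsupp

/-- Monomials in `n` variables, identified with their exponent vectors. -/
abbrev Mon (n : ℕ) := Fin n →₀ ℕ

/-- Total degree of a monomial. -/
def mdeg {n : ℕ} (u : Mon n) : ℕ := u.sum fun _ e => e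

/-- The strict degree reverse lexicographic order with `xₙ ≺ ⋯ ≺ x₁`
(the variable `xᵢ` of the paper corresponds to the index `i - 1 : Fin n`). -/
def drl {n : ℕ} (u v : Mon n) : Prop :=
  mdeg u < mdeg v ∨
    (mdeg u = mdeg v ∧ ∃ i : Fin n, v i < u i ∧ ∀ j : Fin n, i < j → u j = v j)

/-- The reflexive closure of `drl` (`⪯` for degrevlex). -/
def drle {n : ℕ} (u v : Mon n) : Prop := drl u v ∨ u = v

/-- `m` is the degrevlex-leading monomial of `f`. -/
def IsLM {K : Type*} [Field K] {n : ℕ} (f : MvPolynomial (Fin n) K) (m : Mon n) : Prop :=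
  m ∈ f.support ∧ ∀ m' ∈ f.support, m' = m ∨ drl m' m

/-- The degrevlex-leading monomial of `f` (junk value `0` for `f = 0`). -/
noncomputable def lm {K : Type*} [Field K] {n : ℕ} (f : MvPolynomial (Fin n) K) : Mon n := by
  classical exact if h : ∃ m, IsLM f m then h.choose else 0

/-- `xᵢ` is Janet-multiplicative for the monomial `u` with respect to the finite set
`U` of monomials. -/
def JMult {n : ℕ} (U : Finset (Mon n)) (u : Mon n) (i : Fin n) : Prop :=
  ∀ v ∈ U, (∀ j : Fin n, j < i → v j = u j) → v i ≤ u i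

/-- `u` Janet-divides `w` with respect to `U`: `w = u · m` for a monomial `m` involving
only Janet multiplicative variables of `u` w.r.t. `U`. -/
def JDiv {n : ℕ} (U : Finset (Mon n)) (u w : Mon n) : Prop :=
  ∃ m : Mon n, w = u + m ∧ ∀ i : Fin n, m i ≠ 0 → JMult U u i

theorem mdeg_add {n : ℕ} (u v : Mon n) : mdeg (u + v) = mdeg u + mdeg v :=
  Finsupp.sum_add_index' (fun _ => rfl) (fun _ _ _ => rfl)

theorem drl_trans {n : ℕ} {u v w : Mon n} (huv : drl u v) (hvw : drl v w) : drl u w := by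
  rcases huv with h | ⟨h, i, hi, hi'⟩ <;> rcases hvw with h' | ⟨h', j, hj, hj'⟩
  · exact Or.inl (h.trans h')
  · exact Or.inl (h' ▸ h)
  · exact Or.inl (h ▸ h')
  · refine Or.inr ⟨h.trans h', ?_⟩
    rcases lt_trichotomy i j with hij | rfl | hij
    · exact ⟨j, (hi' j hij).symm ▸ hj, fun k hk => (hi' k (hij.trans hk)).trans (hj' k hk)⟩
    · exact ⟨i, hj.trans hi, fun k hk => (hi' k hk).trans (hj' k hk)⟩
    · exact ⟨i, hj' i hij ▸ hi, fun k hk => (hi' k hk).trans (hj' k (hij.trans hk))⟩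

theorem drl_irrefl {n : ℕ} (u : Mon n) : ¬ drl u u := by
  rintro (h | ⟨-, i, hi, -⟩)
  · exact lt_irrefl _ h
  · exact lt_irrefl _ hi

theorem drl_total {n : ℕ} {u v : Mon n} (h : u ≠ v) : drl u v ∨ drl v u := by
  rcases lt_trichotomy (mdeg u) (mdeg v) with hd | hd | hd
  · exact Or.inl (Or.inl hd)
  · have hne : (Finset.univ.filter fun i => u i ≠ v i).Nonempty := by
      obtain ⟨i, hi⟩ := DFunLike.ne_iff.mp h
      exact ⟨i, by simpa using hi⟩
    obtain ⟨i, hi, hmax⟩ := Finset.exists_max_image _ id hne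
    have heq : ∀ j, i < j → u j = v j := fun j hj => by
      by_contra hne'
      exact absurd (hmax j (by simpa using hne')) (not_le.mpr hj)
    rcases lt_or_gt_of_ne (Finset.mem_filter.mp hi).2 with hlt | hlt
    · exact Or.inr (Or.inr ⟨hd.symm, i, hlt, fun j hj => (heq j hj).symm⟩)
    · exact Or.inl (Or.inr ⟨hd, i, hlt, heq⟩)
  · exact Or.inr (Or.inl hd)

theorem drl_add_left {n : ℕ} (a : Mon n) {u v : Mon n} (h : drl u v) : drl (a + u) (a + v) := by
  rcases h with h | ⟨h, i, hi, hi'⟩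
  · left
    simpa only [mdeg_add, add_lt_add_iff_left] using h
  · refine Or.inr ⟨by simp only [mdeg_add, h], i, ?_, fun j hj => ?_⟩
    · simpa using hi
    · simpa using hi' j hj

theorem IsLM.unique {K : Type*} [Field K] {n : ℕ} {f : MvPolynomial (Fin n) K} {u v : Mon n}
    (hu : IsLM f u) (hv : IsLM f v) : u = v := by
  rcases hu.2 v hv.1 with h | h
  · exact h.symm
  · rcases hv.2 u hu.1 with h' | h'
    · exact h'
    · exact absurd (drl_trans h h') (drl_irrefl v)

theorem exists_drl_max {n : ℕ} (s : Finset (Mon n)) (hs : s.Nonempty) :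
    ∃ m ∈ s, ∀ m' ∈ s, m' = m ∨ drl m' m := by
  induction hs using Finset.Nonempty.cons_induction with
  | singleton a => exact ⟨a, by simp, by simp⟩
  | cons a s ha hs ih =>
    obtain ⟨m, hm, hmax⟩ := ih
    rcases drl_total (ne_of_mem_of_not_mem hm ha) with h | h
    · refine ⟨a, by simp, fun m' hm' => ?_⟩
      rcases Finset.mem_cons.mp hm' with rfl | hm'
      · exact Or.inl rfl
      · rcases hmax m' hm' with rfl | h'
        · exact Or.inr h
        · exact Or.inr (drl_trans h' h)
    · refine ⟨m, by simp [hm], fun m' hm' => ?_⟩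
      rcases Finset.mem_cons.mp hm' with rfl | hm'
      · exact Or.inr h
      · exact hmax m' hm'

theorem isLM_lm {K : Type*} [Field K] {n : ℕ} {f : MvPolynomial (Fin n) K} (hf : f ≠ 0) :
    IsLM f (lm f) := by
  have h : ∃ m, IsLM f m := exists_drl_max f.support (MvPolynomial.support_nonempty.mpr hf)
  rw [lm, dif_pos h]
  exact h.choose_spec

theorem IsLM.monomial_mul {K : Type*} [Field K] {n : ℕ} {f : MvPolynomial (Fin n) K} {u : Mon n}
    (hu : IsLM f u) (a : Mon n) : IsLM (monomial a 1 * f) (a + u) := by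
  refine ⟨?_, fun m hm => ?_⟩
  · simpa [MvPolynomial.coeff_monomial_mul] using hu.1
  · rw [MvPolynomial.mem_support_iff, MvPolynomial.coeff_monomial_mul'] at hm
    split_ifs at hm with ham
    · obtain ⟨m, rfl⟩ := exists_add_of_le ham
      rw [add_tsub_cancel_left, one_mul] at hm
      rcases hu.2 m (MvPolynomial.mem_support_iff.mpr hm) with rfl | h
      · exact Or.inl rfl
      · exact Or.inr (drl_add_left a h)
    · exact absurd rfl hm

theorem JDiv.eq_of_mem {n : ℕ} {U : Finset (Mon n)} {u w : Mon n} (hw : w ∈ U)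
    (h : JDiv U u w) : u = w := by
  obtain ⟨m, rfl, hm⟩ := h
  have key : ∀ i, m i = 0 := fun i => by
    induction i using WellFoundedLT.induction with
    | ind i ih =>
      by_contra hi
      have := hm i hi _ hw fun j hj => by simp [ih j hj]
      simp only [Finsupp.add_apply] at this
      omega
  rw [show m = 0 from Finsupp.ext key, add_zero]

theorem exists_bound_inf_mem {n : ℕ} {M : Set (Mon n)} (hM : IsUpperSet M) :
    ∃ D : Mon n, ∀ w ∈ M, w ⊓ D ∈ M := by
  have hfin : {b | Minimal (· ∈ M) b}.Finite :=
    WellQuasiOrderedLE.finite_of_isAntichain (setOfPred_minimal_antichain _)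
  obtain ⟨D, hD⟩ := hfin.bddAbove
  refine ⟨D, fun w hw => ?_⟩
  obtain ⟨b, hbw, hb⟩ := exists_minimal_le_of_wellFoundedLT (· ∈ M) w hw
  exact hM (le_inf hbw (hD hb)) hb.prop

/-- Every set of monomials closed under multiplication has a finite Janet-complete basis. -/
theorem exists_finset_jDiv {n : ℕ} {M : Set (Mon n)} (hM : IsUpperSet M) :
    ∃ U : Finset (Mon n), ↑U ⊆ M ∧ ∀ w ∈ M, ∃ u ∈ U, JDiv U u w := by
  classical
  obtain ⟨D, hD⟩ := exists_bound_inf_mem hM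
  refine ⟨(Finset.Iic D).filter (· ∈ M), fun u hu => (Finset.mem_filter.mp hu).2, fun w hw =>
    ⟨w ⊓ D, by simpa using hD w hw, w - w ⊓ D, (add_tsub_cancel_of_le inf_le_left).symm,
      fun i hi v hv _ => ?_⟩⟩
  have hvD : v i ≤ D i := Finset.mem_Iic.mp (Finset.mem_filter.mp hv).1 i
  simp only [Finsupp.tsub_apply, Finsupp.inf_apply] at hi ⊢
  omega

theorem isUpperSet_lm {K : Type*} [Field K] {n : ℕ} (I : Ideal (MvPolynomial (Fin n) K)) :
    IsUpperSet (lm '' {f | f ∈ I ∧ f ≠ 0}) := by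
  rintro _ v huv ⟨f, ⟨hfI, hf⟩, rfl⟩
  obtain ⟨a, rfl⟩ := exists_add_of_le huv
  have hne : monomial a (1 : K) * f ≠ 0 :=
    mul_ne_zero (by simp) hf
  exact ⟨_, ⟨I.mul_mem_left _ hfI, hne⟩,
    ((isLM_lm hne).unique ((isLM_lm hf).monomial_mul a)).trans (add_comm _ _)⟩

/-- every nonzero ideal of `P` has a finite (head autoreduced) Janet
basis. -/
theorem statement17 {K : Type*} [Field K] {n : ℕ}
    (I : Ideal (MvPolynomial (Fin n) K)) (hI : I ≠ ⊥) :
    ∃ H : Finset (MvPolynomial (Fin n) K),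
      (∀ h ∈ H, h ≠ 0) ∧ (↑H ⊆ (I : Set (MvPolynomial (Fin n) K))) ∧
      (∀ f ∈ I, f ≠ 0 → ∃ h ∈ H, JDiv (H.image lm) (lm h) (lm f)) ∧
      (∀ h ∈ H, ∀ h' ∈ H, h ≠ h' → ¬ JDiv (H.image lm) (lm h') (lm h)) := by
  classical
  obtain ⟨U, hUM, hU⟩ := exists_finset_jDiv (isUpperSet_lm I)
  have hex : ∀ u ∈ U, ∃ f, (f ∈ I ∧ f ≠ 0) ∧ lm f = u := fun u hu => hUM hu
  choose! F hF hlm using hex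
  have himage : (U.image F).image lm = U := by
    rw [Finset.image_image]
    exact (Finset.image_congr fun u hu => hlm _ hu).trans Finset.image_id
  have hmem : ∀ h ∈ U.image F, lm h ∈ U ∧ F (lm h) = h := by
    intro h hh
    obtain ⟨u, hu, rfl⟩ := Finset.mem_image.mp hh
    rw [hlm u hu]
    exact ⟨hu, rfl⟩
  refine ⟨U.image F, ?_, ?_, ?_, ?_⟩
  · intro h hh
    obtain ⟨u, hu, rfl⟩ := Finset.mem_image.mp hh
    exact (hF _ hu).2
  · intro h hh
    obtain ⟨u, hu, rfl⟩ := Finset.mem_image.mp hh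
    exact (hF _ hu).1
  · intro f hfI hf
    obtain ⟨u, hu, hdiv⟩ := hU (lm f) ⟨f, ⟨hfI, hf⟩, rfl⟩
    refine ⟨F u, Finset.mem_image_of_mem F hu, ?_⟩
    convert hdiv
    exact hlm u hu
  · intro h hh h' hh' hne hdiv
    have heq := hdiv.eq_of_mem (Finset.mem_image_of_mem lm hh)
    exact hne ((hmem h hh).2.symm.trans ((congrArg F heq.symm).trans (hmem h' hh').2))
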